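/- arXiv:math/0608264 — 6 statements merged into one kernel-verified Lean document; each statement's English description precedes it below -/
import Mathlib

section
/- For any two tagged edges M and N, there is an elementary move M ↦ N if and only if there is an elementary move τN ↦ M. -/
/-- The number of vertices `|δ_{a,b}|` on the counterclockwise boundary path from `a` to `b`
(including both endpoints); `|δ_{a,a}| = n + 1`. -/
def deltaLen {n : ℕ} (a b : ZMod n) : ℕ :=
  if a = b then n + 1 else (b - a).val + 1

/-- A tagged edge `M_{a,b}^ε` of the punctured polygon with `n` vertices:
`a, b` are vertices with `|δ_{a,b}| ≥ 3`, `ε ∈ {+1, -1}` (an element of `ℤˣ`),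
and `ε = 1` whenever `a ≠ b`. -/
structure TaggedEdge (n : ℕ) where
  a : ZMod n
  b : ZMod n
  ε : ℤˣ
  tag_eq_one : a ≠ b → ε = 1
  three_le : 3 ≤ deltaLen a b

/-- The translation `τ`: `τ M_{a,b} = M_{a-1,b-1}` for `a ≠ b`, and
`τ M_{a,a}^ε = M_{a-1,a-1}^{-ε}`. -/
def tau {n : ℕ} (M : TaggedEdge n) : TaggedEdge n where
  a := M.a - 1
  b := M.b - 1
  ε := if M.a = M.b then -M.ε else M.ε
  tag_eq_one := by
    intro h
    have hab : M.a ≠ M.b := by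
      intro he; exact h (by rw [he])
    rw [if_neg hab]
    exact M.tag_eq_one hab
  three_le := by
    by_cases hab : M.a = M.b
    · have h1 : M.a - 1 = M.b - 1 := by rw [hab]
      have h3 := M.three_le
      unfold deltaLen at h3 ⊢
      rw [if_pos h1]
      rwa [if_pos hab] at h3
    · have h1 : M.a - 1 ≠ M.b - 1 := by
        intro he
        apply hab
        have h2 := congrArg (fun x => x + 1) he
        simpa using h2
      have h2 : M.b - 1 - (M.a - 1) = M.b - M.a := by ring
      have h3 := M.three_le
      unfold deltaLen at h3 ⊢
      rw [if_neg h1, h2]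
      rwa [if_neg hab] at h3

/-- The loop tagged edge `M_{a,a}^{-ε}` obtained from a loop `M_{a,a}^ε` by changing the tag. -/
def negLoop {n : ℕ} (M : TaggedEdge n) (h : M.a = M.b) : TaggedEdge n where
  a := M.a
  b := M.b
  ε := -M.ε
  tag_eq_one := fun hab => absurd h hab
  three_le := M.three_le

/-- `x` lies on the closed counterclockwise boundary interval `[u,v]`. -/
def memCC {n : ℕ} (x u v : ZMod n) : Prop := (x - u).val ≤ (v - u).val

/-- `x` lies on the open counterclockwise boundary interval `]u,v[`. -/
def memOO {n : ℕ} (x u v : ZMod n) : Prop := memCC x u v ∧ x ≠ u ∧ x ≠ v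

open Classical in
/-- The crossing number `e(M,N)` of two tagged edges. -/
noncomputable def crossNum {n : ℕ} (M N : TaggedEdge n) : ℕ :=
  if M.a = M.b then
    (if N.a = N.b then
      (if M.a ≠ N.a ∧ M.ε ≠ N.ε then 1 else 0)
    else
      (if memOO M.a N.a N.b then 1 else 0))
  else
    (if N.a = N.b then
      (if memOO N.a M.a M.b then 1 else 0)
    else
      (if memOO N.a (M.a + 1) M.b ∧ memOO N.b M.a N.a then 2
       else if (memCC N.a (M.a + 1) (M.b - 1) ∧ memCC N.b (M.b + 1) M.a) ∨
               (memCC N.a M.b (M.a - 1) ∧ memCC N.b (M.a + 1) (M.b - 1)) then 1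
       else 0))

/-- There is an elementary move `M ↦ N`. -/
def Move {n : ℕ} (M N : TaggedEdge n) : Prop :=
  (M.a ≠ M.b ∧ 3 ≤ deltaLen M.a M.b ∧ deltaLen M.a M.b ≤ n - 1 ∧
    N.a = M.a ∧ N.b = M.b + 1) ∨
  (M.a ≠ M.b ∧ 4 ≤ deltaLen M.a M.b ∧ deltaLen M.a M.b ≤ n ∧
    N.a = M.a + 1 ∧ N.b = M.b) ∨
  (M.a ≠ M.b ∧ deltaLen M.a M.b = n ∧ N.a = M.a ∧ N.b = M.a) ∨
  (M.a = M.b ∧ N.a = M.a + 1 ∧ N.b = M.a)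

/-- A triangulation: a maximal set of pairwise non-crossing tagged edges. -/
def IsTriangulation {n : ℕ} (T : Set (TaggedEdge n)) : Prop :=
  (∀ M ∈ T, ∀ N ∈ T, crossNum M N = 0) ∧
  (∀ T' : Set (TaggedEdge n), (∀ M ∈ T', ∀ N ∈ T', crossNum M N = 0) → T ⊆ T' → T' = T)

/-- The fan triangulation `T(a₁) = {M_{a₁,a₁}^{+1}, M_{a₁,a₁}^{-1}} ∪
{M_{a₁, a₁+k-1} : 3 ≤ k ≤ n}`. -/
def fan {n : ℕ} (a₁ : ZMod n) : Set (TaggedEdge n) :=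
  {M | M.a = a₁ ∧ (M.b = a₁ ∨ ∃ k : ℕ, 3 ≤ k ∧ k ≤ n ∧ M.b = a₁ + (k : ZMod n) - 1)}

open Classical in
/-- The translation `τ_Γ` of the translation quiver `Γ`. -/
noncomputable def tauGamma {n : ℕ} (a₁ : ZMod n) (v : ℤ × TaggedEdge n) :
    ℤ × TaggedEdge n :=
  if v.2 ∈ fan a₁ then (v.1 - 1, tau v.2) else (v.1, tau v.2)

/-- The arrows of the quiver `Γ` with vertex set `ℤ × (tagged edges)`. -/
def GammaArrow {n : ℕ} (a₁ : ZMod n) (v w : ℤ × TaggedEdge n) : Prop :=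
  (Move v.2 w.2 ∧ (w.2 ∉ fan a₁ ∨ (v.2 ∈ fan a₁ ∧ w.2 ∈ fan a₁)) ∧ w.1 = v.1) ∨
  (Move v.2 w.2 ∧ w.2 ∈ fan a₁ ∧ v.2 ∉ fan a₁ ∧ w.1 = v.1 + 1)

theorem deltaLen_self {n : ℕ} (a : ZMod n) : deltaLen a a = n + 1 := if_pos rfl

theorem deltaLen_of_ne {n : ℕ} {a b : ZMod n} (h : a ≠ b) : deltaLen a b = (b - a).val + 1 :=
  if_neg h

theorem deltaLen_le_iff_ne {n : ℕ} [NeZero n] (a b : ZMod n) : deltaLen a b ≤ n ↔ a ≠ b := by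
  refine ⟨?_, fun h => ?_⟩
  · rintro h rfl
    rw [deltaLen_self] at h
    omega
  · rw [deltaLen_of_ne h]
    exact ZMod.val_lt _

theorem deltaLen_sub_one_sub_one {n : ℕ} (a b : ZMod n) :
    deltaLen (a - 1) (b - 1) = deltaLen a b := by
  simp [deltaLen]

theorem deltaLen_add_one_add_one {n : ℕ} (a b : ZMod n) :
    deltaLen (a + 1) (b + 1) = deltaLen a b := by
  simp [deltaLen]

theorem deltaLen_add_one_right {n : ℕ} (hn : 2 ≤ n) {a b : ZMod n} (h : a ≠ b) :
    deltaLen a (b + 1) = deltaLen a b + 1 := by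
  have : Fact (1 < n) := ⟨hn⟩
  have : NeZero n := ⟨by omega⟩
  have hlt := ZMod.val_lt (b - a)
  have hsub : b + 1 - a = b - a + 1 := by ring
  rw [deltaLen_of_ne h]
  by_cases hab : a = b + 1
  · have hval : b - a = -1 := by rw [hab]; ring
    rw [← hab, deltaLen_self, hval]
    obtain ⟨m, rfl⟩ : ∃ m, n = m + 1 := ⟨n - 1, by omega⟩
    rw [ZMod.val_neg_one]
  · rw [deltaLen_of_ne hab, hsub]
    have hne : (b - a).val + 1 ≠ n := by
      intro hv
      apply hab
      have hcast : (((b - a).val + 1 : ℕ) : ZMod n) = 0 := by rw [hv, ZMod.natCast_self]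
      rw [Nat.cast_add, ZMod.natCast_zmod_val, Nat.cast_one] at hcast
      linear_combination -hcast
    rw [ZMod.val_add_of_lt (by rw [ZMod.val_one]; omega), ZMod.val_one]

theorem deltaLen_sub_one_left {n : ℕ} (hn : 2 ≤ n) {a b : ZMod n} (h : a ≠ b) :
    deltaLen (a - 1) b = deltaLen a b + 1 := by
  rw [← deltaLen_add_one_add_one (a - 1), sub_add_cancel, deltaLen_add_one_right hn h]

theorem eq_add_one_of_deltaLen_eq {n : ℕ} (hn : 2 ≤ n) {a b : ZMod n} (h : deltaLen a b = n) :
    a = b + 1 := by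
  have : NeZero n := ⟨by omega⟩
  have hab : a ≠ b := (deltaLen_le_iff_ne a b).1 h.le
  by_contra hne
  have := (deltaLen_le_iff_ne a (b + 1)).2 hne
  rw [deltaLen_add_one_right hn hab] at this
  omega

theorem deltaLen_add_one_self {n : ℕ} (hn : 2 ≤ n) (a : ZMod n) : deltaLen (a + 1) a = n := by
  have : Fact (1 < n) := ⟨hn⟩
  have h := deltaLen_add_one_right hn (a := a + 1) (b := a) (by simp)
  rw [deltaLen_self] at h
  omega

theorem Move.tau_move {n : ℕ} (hn : 3 ≤ n) {M N : TaggedEdge n} (h : Move M N) :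
    Move (tau N) M := by
  have hn2 : 2 ≤ n := by omega
  have : Fact (1 < n) := ⟨hn2⟩
  have : NeZero n := ⟨by omega⟩
  rcases h with ⟨hab, h3, hle, ha, hb⟩ | ⟨hab, h4, hle, ha, hb⟩ | ⟨-, hd, ha, hb⟩ | ⟨hab, ha, hb⟩
  · have hlen : deltaLen (tau N).a (tau N).b = deltaLen M.a M.b + 1 := by
      rw [← deltaLen_add_one_right hn2 hab, ← ha, ← hb]
      exact deltaLen_sub_one_sub_one _ _
    refine Or.inr (Or.inl ⟨(deltaLen_le_iff_ne _ _).1 (by omega), by omega, by omega, ?_, ?_⟩)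
    · simp [tau, ha]
    · simp [tau, hb]
  · have hne : M.a + 1 ≠ M.b := by
      intro he
      rw [deltaLen_of_ne hab, ← he, add_sub_cancel_left, ZMod.val_one] at h4
      omega
    have hlen : deltaLen (tau N).a (tau N).b + 1 = deltaLen M.a M.b := by
      have h := deltaLen_sub_one_left hn2 hne
      rw [add_sub_cancel_right] at h
      rw [h, ← ha, ← hb]
      exact congrArg (· + 1) (deltaLen_sub_one_sub_one _ _)
    refine Or.inl ⟨(deltaLen_le_iff_ne _ _).1 (by omega), by omega, by omega, ?_, ?_⟩
    · simp [tau, ha]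
    · simp [tau, hb]
  · have hab := eq_add_one_of_deltaLen_eq hn2 hd
    refine Or.inr (Or.inr (Or.inr ⟨?_, ?_, ?_⟩))
    · simp [tau, ha, hb]
    · simp [tau, ha]
    · simp [tau, ha, hab]
  · have hlen : deltaLen (tau N).a (tau N).b = n := by
      have h := deltaLen_sub_one_sub_one N.a N.b
      rwa [ha, hb, deltaLen_add_one_self hn2, ← ha, ← hb] at h
    refine Or.inr (Or.inr (Or.inl ⟨(deltaLen_le_iff_ne _ _).1 hlen.le, hlen, ?_, ?_⟩))
    · simp [tau, ha]
    · simp [tau, ha, ← hab]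

theorem move_tau_tau_iff {n : ℕ} (M N : TaggedEdge n) : Move (tau M) (tau N) ↔ Move M N := by
  have shift (x y : ZMod n) : x - 1 = y - 1 + 1 ↔ x = y + 1 := by
    rw [sub_eq_iff_eq_add, sub_add_cancel]
  simp only [Move, tau, deltaLen_sub_one_sub_one, sub_left_inj, ne_eq, shift]

/-- There is an elementary move `M ↦ N` iff there is an elementary move
`τN ↦ M`. -/
theorem move_iff_move_of_tau (n : ℕ) (hn : 3 ≤ n) (M N : TaggedEdge n) :
    Move M N ↔ Move (tau N) M :=
  ⟨Move.tau_move hn, fun h => (move_tau_tau_iff M N).1 (h.tau_move hn)⟩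
end

section
/- Every triangulation of the punctured polygon has exactly n elements. -/
/-- Two intervals of natural numbers cross, the first one starting before the second one. -/
def IntervalCross (I J : ℕ × ℕ) : Prop := I.1 < J.1 ∧ J.1 < I.2 ∧ I.2 < J.2

/-- In a maximal non-crossing family, each interval has an apex splitting it into two intervals,
each of which is a unit interval or belongs to the family. -/
theorem exists_apex {N : ℕ} {S : Set (ℕ × ℕ)} (hS : ∀ I ∈ S, I.1 + 2 ≤ I.2 ∧ I.2 ≤ N)
    (hc : ∀ I ∈ S, ∀ J ∈ S, ¬ IntervalCross I J)
    (hmax : ∀ I : ℕ × ℕ, I.1 + 2 ≤ I.2 → I.2 ≤ N →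
      (∀ J ∈ S, ¬ IntervalCross I J ∧ ¬ IntervalCross J I) → I ∈ S)
    (I : ℕ × ℕ) (hI : I ∈ S) :
    ∃ m, I.1 < m ∧ m < I.2 ∧ (m = I.1 + 1 ∨ (I.1, m) ∈ S) ∧ (m + 1 = I.2 ∨ (m, I.2) ∈ S) := by
  classical
  obtain ⟨i, j⟩ := I
  have hij := hS _ hI
  simp only at hij ⊢
  let P : ℕ → Prop := fun k => k < j ∧ (k = i + 1 ∨ (i, k) ∈ S)
  have hP : P (Nat.findGreatest P j) :=
    Nat.findGreatest_spec (P := P) (m := i + 1) (by omega) ⟨by omega, Or.inl rfl⟩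
  have hge : ∀ k, P k → k ≤ Nat.findGreatest P j :=
    fun k hk => Nat.le_findGreatest hk.1.le hk
  generalize Nat.findGreatest P j = m at hP hge
  obtain ⟨hmj, hm⟩ := hP
  have him : i < m := by
    rcases hm with h | h
    · omega
    · have := hS _ h
      simp only at this
      omega
  refine ⟨m, him, hmj, hm, ?_⟩
  by_cases hj : m + 1 = j
  · exact Or.inl hj
  refine Or.inr (hmax _ (by simp only; omega) hij.2 ?_)
  rintro ⟨c, d⟩ hJ
  have h1 := hc _ hI _ hJ
  have h2 := hc _ hJ _ hI
  have hcd := hS _ hJ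
  have h3 : ¬ (i < c ∧ c < m ∧ m < d) := by
    rcases hm with h | h
    · omega
    · exact hc _ h _ hJ
  have h4 : c = i → d < j → d ≤ m := by
    rintro rfl hd
    exact hge d ⟨hd, Or.inr hJ⟩
  simp only [IntervalCross] at *
  omega

/-- A maximal non-crossing family of intervals of length at least two in `[0, N]` has `N - 1`
elements. -/
theorem ncard_maximal_noncrossing {N : ℕ} (hN : 2 ≤ N) {S : Set (ℕ × ℕ)}
    (hS : ∀ I ∈ S, I.1 + 2 ≤ I.2 ∧ I.2 ≤ N)
    (hc : ∀ I ∈ S, ∀ J ∈ S, ¬ IntervalCross I J)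
    (hmax : ∀ I : ℕ × ℕ, I.1 + 2 ≤ I.2 → I.2 ≤ N →
      (∀ J ∈ S, ¬ IntervalCross I J ∧ ¬ IntervalCross J I) → I ∈ S) :
    S.ncard = N - 1 := by
  have htop : ((0, N) : ℕ × ℕ) ∈ S := by
    refine hmax _ (by simpa using hN) le_rfl ?_
    intro J hJ
    have := hS J hJ
    simp only [IntervalCross]
    omega
  choose! m hm1 hm2 hm3 hm4 using exists_apex hS hc hmax
  have hsub : ∀ I ∈ S, ∀ J ∈ S, J.1 < m I → m I < J.2 → J.1 ≤ I.1 ∧ I.2 ≤ J.2 := by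
    intro I hI J hJ h1 h2
    have a1 := hm1 I hI
    have a2 := hm2 I hI
    constructor
    · rcases hm3 I hI with h | h
      · omega
      · have := hc _ h _ hJ
        simp only [IntervalCross] at this
        omega
    · rcases hm4 I hI with h | h
      · omega
      · have := hc _ hJ _ h
        simp only [IntervalCross] at this
        omega
  have hbij : S.ncard = (Set.Ioo 0 N).ncard := by
    refine Set.ncard_congr (fun I _ => m I) ?_ ?_ ?_
    · intro I hI
      have := hm1 I hI
      have := hm2 I hI
      have := hS I hI
      exact ⟨by omega, by omega⟩
    · intro I J hI hJ h
      have a := hsub I hI J hJ (by have := hm1 J hJ; omega) (by have := hm2 J hJ; omega)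
      have b := hsub J hJ I hI (by have := hm1 I hI; omega) (by have := hm2 I hI; omega)
      exact Prod.ext (by omega) (by omega)
    · intro x hx
      obtain ⟨I, ⟨hI, hIx1, hIx2⟩, hmin⟩ :=
        (measure (fun I : ℕ × ℕ => I.2 - I.1)).wf.has_min
          {I | I ∈ S ∧ I.1 < x ∧ x < I.2} ⟨(0, N), htop, hx.1, hx.2⟩
      have hmin' : ∀ J ∈ S, J.1 < x → x < J.2 → I.2 - I.1 ≤ J.2 - J.1 :=
        fun J hJ h1 h2 => not_lt.1 (hmin J ⟨hJ, h1, h2⟩)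
      have a1 := hm1 I hI
      have a2 := hm2 I hI
      refine ⟨I, hI, ?_⟩
      rcases lt_trichotomy x (m I) with h | h | h
      · rcases hm3 I hI with h' | h'
        · omega
        · have := hmin' _ h' hIx1 h
          simp only at this
          omega
      · exact h.symm
      · rcases hm4 I hI with h' | h'
        · omega
        · have := hmin' _ h' h hIx2
          simp only at this
          omega
  rw [hbij, Set.ncard_eq_toFinset_card', Set.toFinset_Ioo, Nat.card_Ioo]
  omega

/-- The position of `x` when walking counterclockwise from `p`. -/
def vertexPos {n : ℕ} (p x : ZMod n) : ℕ := (x - p).val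

theorem vertexPos_lt {n : ℕ} [NeZero n] (p x : ZMod n) : vertexPos p x < n := ZMod.val_lt _

theorem vertexPos_inj {n : ℕ} [NeZero n] (p x y : ZMod n) :
    x = y ↔ vertexPos p x = vertexPos p y := by
  refine ⟨fun h => by rw [h], fun h => ?_⟩
  simpa using ZMod.val_injective n h

theorem vertexPos_self {n : ℕ} [NeZero n] (p : ZMod n) : vertexPos p p = 0 := by
  simp [vertexPos]

theorem val_sub_cases {n : ℕ} [NeZero n] (p x u : ZMod n) :
    (vertexPos p u ≤ vertexPos p x ∧ (x - u).val + vertexPos p u = vertexPos p x) ∨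
    (vertexPos p x < vertexPos p u ∧ (x - u).val + vertexPos p u = vertexPos p x + n) := by
  have h : x - u + (u - p) = x - p := by ring
  have hl := ZMod.val_lt (x - u)
  unfold vertexPos
  rcases lt_or_ge ((x - u).val + (u - p).val) n with h' | h'
  · have := ZMod.val_add_of_lt h'
    rw [h] at this
    omega
  · have := ZMod.val_add_val_of_le h'
    rw [h] at this
    omega

theorem vertexPos_add_one {n : ℕ} [NeZero n] (hn : 2 ≤ n) (p x : ZMod n) :
    vertexPos p (x + 1) = if vertexPos p x = n - 1 then 0 else vertexPos p x + 1 := by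
  have : Fact (1 < n) := ⟨hn⟩
  have h := val_sub_cases p (x + 1) x
  rw [add_sub_cancel_left, ZMod.val_one] at h
  have h1 := vertexPos_lt p x
  have h2 := vertexPos_lt p (x + 1)
  split_ifs <;> omega

theorem vertexPos_sub_one {n : ℕ} [NeZero n] (hn : 2 ≤ n) (p x : ZMod n) :
    vertexPos p (x - 1) = if vertexPos p x = 0 then n - 1 else vertexPos p x - 1 := by
  have h := vertexPos_add_one hn p (x - 1)
  rw [sub_add_cancel] at h
  have := vertexPos_lt p (x - 1)
  split_ifs at * <;> omega

theorem memCC_iff {n : ℕ} [NeZero n] (p x u v : ZMod n) :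
    memCC x u v ↔
      (vertexPos p u ≤ vertexPos p v ∧
        vertexPos p u ≤ vertexPos p x ∧ vertexPos p x ≤ vertexPos p v) ∨
      (vertexPos p v < vertexPos p u ∧
        (vertexPos p u ≤ vertexPos p x ∨ vertexPos p x ≤ vertexPos p v)) := by
  have h1 := val_sub_cases p x u
  have h2 := val_sub_cases p v u
  have h3 := vertexPos_lt p x
  have h4 := vertexPos_lt p v
  unfold memCC
  omega

theorem memOO_iff {n : ℕ} [NeZero n] (p x u v : ZMod n) :
    memOO x u v ↔
      (vertexPos p u ≤ vertexPos p v ∧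
        vertexPos p u < vertexPos p x ∧ vertexPos p x < vertexPos p v) ∨
      (vertexPos p v < vertexPos p u ∧
        (vertexPos p u < vertexPos p x ∨ vertexPos p x < vertexPos p v)) := by
  unfold memOO
  rw [memCC_iff p, Ne, Ne, vertexPos_inj p x u, vertexPos_inj p x v]
  omega

theorem TaggedEdge.two_le_val {n : ℕ} (M : TaggedEdge n) (h : M.a ≠ M.b) :
    2 ≤ (M.b - M.a).val := by
  have := M.three_le
  rw [deltaLen, if_neg h] at this
  omega

/-- The crossing relation of two edges between distinct vertices. -/
theorem crossNum_eq_zero_iff {n : ℕ} {M N : TaggedEdge n} (hM : M.a ≠ M.b) (hN : N.a ≠ N.b) :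
    crossNum M N = 0 ↔
      ¬ (memOO N.a (M.a + 1) M.b ∧ memOO N.b M.a N.a) ∧
      ¬ (memCC N.a (M.a + 1) (M.b - 1) ∧ memCC N.b (M.b + 1) M.a) ∧
      ¬ (memCC N.a M.b (M.a - 1) ∧ memCC N.b (M.a + 1) (M.b - 1)) := by
  unfold crossNum
  rw [if_neg hM, if_neg hN]
  split_ifs <;> simp <;> tauto

/-- The position of the end of an edge starting at distance less than `n` after `p` and not
passing over `p`. -/
def endPos {n : ℕ} (p b : ZMod n) : ℕ := if b = p then n else vertexPos p b

/-- Two edges, none of which passes over `p`, cross if and only if the corresponding intervals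
do. -/
theorem crossNum_arcs_iff {n : ℕ} [NeZero n] (hn : 3 ≤ n) (p : ZMod n) {M N : TaggedEdge n}
    (hM : M.a ≠ M.b) (hN : N.a ≠ N.b) (hMp : ¬ memOO p M.a M.b) (hNp : ¬ memOO p N.a N.b) :
    crossNum M N = 0 ↔
      ¬ IntervalCross (vertexPos p M.a, endPos p M.b) (vertexPos p N.a, endPos p N.b) ∧
      ¬ IntervalCross (vertexPos p N.a, endPos p N.b) (vertexPos p M.a, endPos p M.b) := by
  rw [crossNum_eq_zero_iff hM hN]
  have hM2 := M.two_le_val hM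
  have hN2 := N.two_le_val hN
  have hMv := val_sub_cases p M.b M.a
  have hNv := val_sub_cases p N.b N.a
  have l1 := vertexPos_lt p M.a
  have l2 := vertexPos_lt p M.b
  have l3 := vertexPos_lt p N.a
  have l4 := vertexPos_lt p N.b
  have e1 := vertexPos_add_one (by omega) p M.a
  have e2 := vertexPos_add_one (by omega) p M.b
  have e3 := vertexPos_sub_one (by omega) p M.a
  have e4 := vertexPos_sub_one (by omega) p M.b
  simp only [memOO_iff p, memCC_iff p, IntervalCross, endPos, vertexPos_inj p _ p, Ne,
    vertexPos_inj p M.a, vertexPos_inj p N.a, vertexPos_self] at *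
  generalize (M.b - M.a).val = u at *
  generalize (N.b - N.a).val = v at *
  generalize vertexPos p (M.a + 1) = a1 at *
  generalize vertexPos p (M.b + 1) = b1 at *
  generalize vertexPos p (M.a - 1) = a2 at *
  generalize vertexPos p (M.b - 1) = b2 at *
  generalize vertexPos p M.a = a at *
  generalize vertexPos p M.b = b at *
  generalize vertexPos p N.a = x at *
  generalize vertexPos p N.b = y at *
  clear hM hN
  have k1 : b = 0 ∨ a + 2 ≤ b := by omega
  have k2 : y = 0 ∨ x + 2 ≤ y := by omega
  have k3 : a ≠ n - 1 := by omega
  rw [if_neg k3] at e1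
  split_ifs at * <;> subst_vars <;> omega

/-- The edges which do not cross the loop at `p` with tag `ε`. -/
def AvoidsLoop {n : ℕ} (p : ZMod n) (ε : ℤˣ) (M : TaggedEdge n) : Prop :=
  (M.a = M.b → M.a = p ∨ M.ε = ε) ∧ (M.a ≠ M.b → ¬ memOO p M.a M.b)

theorem crossNum_loop_left {n : ℕ} {L : TaggedEdge n} (hL : L.a = L.b) (M : TaggedEdge n) :
    crossNum L M = 0 ↔ AvoidsLoop L.a L.ε M := by
  unfold crossNum AvoidsLoop
  rw [if_pos hL]
  by_cases h : M.a = M.b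
  · rw [if_pos h, eq_comm (a := M.a) (b := L.a), eq_comm (a := M.ε)]
    split_ifs <;> simp <;> tauto
  · rw [if_neg h]
    split_ifs <;> simp <;> tauto

theorem crossNum_loop_right {n : ℕ} {L : TaggedEdge n} (hL : L.a = L.b) (M : TaggedEdge n) :
    crossNum M L = 0 ↔ AvoidsLoop L.a L.ε M := by
  unfold crossNum AvoidsLoop
  rw [if_pos hL, if_pos hL]
  by_cases h : M.a = M.b
  · rw [if_pos h]
    split_ifs <;> simp <;> tauto
  · rw [if_neg h]
    split_ifs <;> simp <;> tauto

open Classical in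
/-- The interval corresponding to an edge after cutting along the loop at `p` with tag `ε`, the
puncture being at position `n + 1`. -/
noncomputable def edgeInterval {n : ℕ} (p : ZMod n) (ε : ℤˣ) (M : TaggedEdge n) : ℕ × ℕ :=
  if M.a = M.b then
    if M.a = p ∧ M.ε ≠ ε then (0, n) else (vertexPos p M.a, n + 1)
  else (vertexPos p M.a, endPos p M.b)

theorem edgeInterval_arc {n : ℕ} [NeZero n] {p : ZMod n} {ε : ℤˣ} {M : TaggedEdge n}
    (hM : AvoidsLoop p ε M) (h : M.a ≠ M.b) :
    vertexPos p M.a + 2 ≤ endPos p M.b ∧ endPos p M.b ≤ n ∧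
      (0 < vertexPos p M.a ∨ endPos p M.b < n) := by
  have h1 := hM.2 h
  have h2 := M.two_le_val h
  have h3 := val_sub_cases p M.b M.a
  have l1 := vertexPos_lt p M.a
  have l2 := vertexPos_lt p M.b
  simp only [memOO_iff p, endPos, vertexPos_inj p _ p, Ne, vertexPos_self,
    vertexPos_inj p M.a] at *
  split_ifs <;> omega

theorem edgeInterval_bounds {n : ℕ} [NeZero n] {p : ZMod n} {ε : ℤˣ} {M : TaggedEdge n}
    (hn : 2 ≤ n) (hM : AvoidsLoop p ε M) :
    (edgeInterval p ε M).1 + 2 ≤ (edgeInterval p ε M).2 ∧ (edgeInterval p ε M).2 ≤ n + 1 := by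
  have l1 := vertexPos_lt p M.a
  unfold edgeInterval
  split_ifs with h1 h2
  · simp only; omega
  · simp only; omega
  · have := edgeInterval_arc hM h1
    simp only; omega

theorem crossNum_iff_intervalCross {n : ℕ} [NeZero n] (hn : 3 ≤ n) {p : ZMod n} {ε : ℤˣ}
    {M N : TaggedEdge n} (hM : AvoidsLoop p ε M) (hN : AvoidsLoop p ε N) :
    crossNum M N = 0 ↔ ¬ IntervalCross (edgeInterval p ε M) (edgeInterval p ε N) ∧
      ¬ IntervalCross (edgeInterval p ε N) (edgeInterval p ε M) := by
  have l1 := vertexPos_lt p M.a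
  have l2 := vertexPos_lt p N.a
  have l3 := vertexPos_lt p M.b
  have l4 := vertexPos_lt p N.b
  by_cases h1 : M.a = M.b
  · rw [crossNum_loop_left h1]
    by_cases h2 : N.a = N.b
    · have h3 := hM.1 h1
      have h4 := hN.1 h2
      have h5 : M.ε ≠ ε → N.ε ≠ ε → N.ε = M.ε := by
        rcases Int.units_eq_one_or M.ε with h | h <;> rcases Int.units_eq_one_or N.ε with h' | h' <;>
          rcases Int.units_eq_one_or ε with h'' | h'' <;> simp [h, h', h'']
      rw [vertexPos_inj p _ p, vertexPos_self] at h3 h4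
      simp only [AvoidsLoop, edgeInterval, if_pos h1, if_true, IntervalCross,
        ne_eq, h2, not_true_eq_false, false_implies, true_implies, and_true,
        vertexPos_inj p _ p, vertexPos_inj p _ M.a, vertexPos_self]
      rw [h2] at h4 l2
      by_cases c1 : M.ε = ε <;> by_cases c2 : N.ε = ε
      · simp only [c1, c2, not_true_eq_false, and_false, if_false, or_true, true_iff]
        omega
      · have h6 := h4.resolve_right c2
        simp only [c1, c2, h6, not_true_eq_false, not_false_eq_true, and_false, and_true,
          if_false, if_true, or_false]
        omega
      · have h6 := h3.resolve_right c1
        have h7 : ¬ ε = M.ε := fun h => c1 h.symm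
        simp only [c1, c2, h6, h7, not_true_eq_false, not_false_eq_true, and_false, and_true,
          if_false, if_true, or_false]
        omega
      · simp only [h3.resolve_right c1, h4.resolve_right c2, c1, c2, not_false_eq_true, and_true,
          if_true, true_or, true_iff]
        omega
    · have h4 := edgeInterval_arc hN h2
      have h5 := hM.1 h1
      have h6 := hN.2 h2
      have h7 := vertexPos_self p
      simp only [AvoidsLoop, edgeInterval, if_pos h1, IntervalCross, h2, ne_eq,
        not_false_eq_true, false_implies, true_implies, true_and, memOO_iff p, endPos,
        vertexPos_inj p _ p, vertexPos_self] at *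
      split_ifs at * <;> simp only at * <;> omega
  · by_cases h2 : N.a = N.b
    · rw [crossNum_loop_right h2]
      have h4 := edgeInterval_arc hM h1
      have h5 := hN.1 h2
      have h6 := hM.2 h1
      have h7 := vertexPos_self p
      simp only [AvoidsLoop, edgeInterval, if_pos h2, IntervalCross, h1, ne_eq,
        not_false_eq_true, false_implies, true_implies, true_and, memOO_iff p, endPos,
        vertexPos_inj p _ p, vertexPos_self] at *
      split_ifs at * <;> simp only at * <;> omega
    · rw [crossNum_arcs_iff hn p h1 h2 (hM.2 h1) (hN.2 h2)]
      simp only [edgeInterval, if_neg h1, if_neg h2]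

theorem endPos_injective {n : ℕ} [NeZero n] (p : ZMod n) : Function.Injective (endPos p) := by
  intro x y h
  have l1 := vertexPos_lt p x
  have l2 := vertexPos_lt p y
  unfold endPos at h
  split_ifs at h with h1 h2 h2
  · rw [h1, h2]
  · omega
  · omega
  · exact (vertexPos_inj p x y).2 h

theorem TaggedEdge.ext_fields {n : ℕ} {M N : TaggedEdge n} (ha : M.a = N.a) (hb : M.b = N.b)
    (he : M.ε = N.ε) : M = N := by
  cases M; cases N; simp_all

theorem edgeInterval_injOn {n : ℕ} [NeZero n] (p : ZMod n) (ε : ℤˣ) :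
    Set.InjOn (edgeInterval p ε) {M | AvoidsLoop p ε M} := by
  intro M hM N hN h
  have l1 := vertexPos_lt p M.a
  have l2 := vertexPos_lt p N.a
  have key : ∀ M N : TaggedEdge n, AvoidsLoop p ε N → M.a = M.b → N.a ≠ N.b →
      edgeInterval p ε M ≠ edgeInterval p ε N := by
    intro M N hN h1 h2 h
    have h4 := edgeInterval_arc hN h2
    simp only [edgeInterval, if_pos h1, if_neg h2] at h
    split_ifs at h <;> simp only [Prod.mk.injEq] at h <;> omega
  by_cases h1 : M.a = M.b <;> by_cases h2 : N.a = N.b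
  · have h3 := hM.1 h1
    have h4 := hN.1 h2
    simp only [edgeInterval, if_pos h1, if_pos h2] at h
    split_ifs at h with c1 c2 c2 <;> simp only [Prod.mk.injEq] at h
    · refine TaggedEdge.ext_fields (by rw [c1.1, c2.1]) (by rw [← h1, ← h2, c1.1, c2.1]) ?_
      rw [Int.units_ne_iff_eq_neg.1 c1.2, Int.units_ne_iff_eq_neg.1 c2.2]
    · omega
    · omega
    · have h5 := (vertexPos_inj p _ _).2 h.1
      refine TaggedEdge.ext_fields h5 (by rw [← h1, ← h2, h5]) ?_
      have h6 : M.ε = ε := by tauto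
      have h7 : N.ε = ε := by tauto
      rw [h6, h7]
  · exact absurd h (key M N hN h1 h2)
  · exact absurd h.symm (key N M hM h2 h1)
  · simp only [edgeInterval, if_neg h1, if_neg h2, Prod.mk.injEq] at h
    exact TaggedEdge.ext_fields ((vertexPos_inj p _ _).2 h.1) (endPos_injective p h.2)
      (by rw [M.tag_eq_one h1, N.tag_eq_one h2])

theorem vertexPos_add_natCast {n : ℕ} [NeZero n] (p : ZMod n) {i : ℕ} (hi : i < n) :
    vertexPos p (p + i) = i := by
  rw [vertexPos, add_sub_cancel_left, ZMod.val_natCast, Nat.mod_eq_of_lt hi]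

/-- The loop at `a` with tag `ε`. -/
def TaggedEdge.loop {n : ℕ} (hn : 2 ≤ n) (a : ZMod n) (ε : ℤˣ) : TaggedEdge n where
  a := a
  b := a
  ε := ε
  tag_eq_one := fun h => absurd rfl h
  three_le := by
    rw [deltaLen, if_pos rfl]
    omega

theorem exists_edgeInterval_eq {n : ℕ} [NeZero n] (hn : 2 ≤ n) (p : ZMod n) (ε : ℤˣ)
    (I : ℕ × ℕ) (h1 : I.1 + 2 ≤ I.2) (h2 : I.2 ≤ n + 1) :
    ∃ M, AvoidsLoop p ε M ∧ edgeInterval p ε M = I := by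
  obtain ⟨i, j⟩ := I
  simp only at h1 h2
  have hi := vertexPos_add_natCast p (i := i) (by omega)
  by_cases hj : j = n + 1
  · subst hj
    refine ⟨TaggedEdge.loop hn (p + i) ε, ⟨fun _ => Or.inr rfl, fun h => absurd rfl h⟩, ?_⟩
    simp [edgeInterval, TaggedEdge.loop, hi]
  by_cases h0 : i = 0 ∧ j = n
  · obtain ⟨rfl, rfl⟩ := h0
    refine ⟨TaggedEdge.loop hn p (-ε), ⟨fun _ => Or.inl rfl, fun h => absurd rfl h⟩, ?_⟩
    simp [edgeInterval, TaggedEdge.loop]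
  have hj' : endPos p (p + j) = j ∧ vertexPos p (p + j) = if j = n then 0 else j := by
    by_cases hjn : j = n
    · subst hjn
      simp [endPos, vertexPos]
    · have := vertexPos_add_natCast p (i := j) (by omega)
      have hne : ¬ p + (j : ZMod n) = p := by
        rw [vertexPos_inj p, vertexPos_self, this]
        omega
      rw [endPos, if_neg hne, if_neg hjn]
      exact ⟨this, this⟩
  obtain ⟨hj1, hj2⟩ := hj'
  have hab : p + (i : ZMod n) ≠ p + (j : ZMod n) := by
    rw [Ne, vertexPos_inj p, hi, hj2]
    split_ifs <;> omega
  have hval := val_sub_cases p (p + (j : ZMod n)) (p + i)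
  have hlt := ZMod.val_lt (p + (j : ZMod n) - (p + (i : ZMod n)))
  refine ⟨⟨p + i, p + j, 1, fun _ => rfl, ?_⟩, ⟨fun h => absurd h hab, fun _ => ?_⟩, ?_⟩
  · rw [deltaLen, if_neg hab]
    rw [hi, hj2] at hval
    split_ifs at hval <;> omega
  · simp only [memOO_iff p, hi, hj2, vertexPos_self]
    split_ifs <;> omega
  · simp only [edgeInterval, if_neg hab, hi, hj1]

theorem IsTriangulation.mem_of_crossNum_eq_zero {n : ℕ} {T : Set (TaggedEdge n)}
    (hT : IsTriangulation T) {M : TaggedEdge n} (hM : crossNum M M = 0)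
    (h : ∀ N ∈ T, crossNum M N = 0 ∧ crossNum N M = 0) : M ∈ T := by
  have := hT.2 (insert M T) ?_ (Set.subset_insert M T)
  · rw [← this]
    exact Set.mem_insert M T
  · rintro A (rfl | hA) B (rfl | hB)
    · exact hM
    · exact (h B hB).1
    · exact (h A hA).2
    · exact hT.1 A hA B hB

/-- The start of an edge which is not shorter than `N` is not in the interior of `N`, if the two
edges do not cross. -/
theorem not_memOO_of_val_le {n : ℕ} [NeZero n] (hn : 3 ≤ n) {M N : TaggedEdge n}
    (hM : M.a ≠ M.b) (hN : N.a ≠ N.b) (hMN : crossNum M N = 0)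
    (hle : (N.b - N.a).val ≤ (M.b - M.a).val) : ¬ memOO M.a N.a N.b := by
  rw [crossNum_eq_zero_iff hM hN] at hMN
  have hM2 := M.two_le_val hM
  have hMv := val_sub_cases M.a M.b M.a
  have hNv := val_sub_cases M.a N.b N.a
  have l2 := vertexPos_lt M.a M.b
  have l3 := vertexPos_lt M.a N.a
  have l4 := vertexPos_lt M.a N.b
  have e1 := vertexPos_add_one (by omega) M.a M.a
  have e2 := vertexPos_add_one (by omega) M.a M.b
  have e3 := vertexPos_sub_one (by omega) M.a M.a
  have e4 := vertexPos_sub_one (by omega) M.a M.b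
  simp only [memOO_iff M.a, memCC_iff M.a, vertexPos_self] at *
  split_ifs at * <;> omega

theorem IsTriangulation.exists_loop {n : ℕ} (hn : 3 ≤ n) {T : Set (TaggedEdge n)}
    (hT : IsTriangulation T) : ∃ L ∈ T, L.a = L.b := by
  have : NeZero n := ⟨by omega⟩
  by_contra! hno
  have key : ∃ a : ZMod n, ∀ N ∈ T, ¬ memOO a N.a N.b := by
    rcases T.eq_empty_or_nonempty with rfl | hne
    · exact ⟨0, by simp⟩
    · obtain ⟨M, hM, hmin⟩ :=
        (measure (fun M : TaggedEdge n => n - (M.b - M.a).val)).wf.has_min T hne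
      refine ⟨M.a, fun N hN => not_memOO_of_val_le hn (hno M hM) (hno N hN)
        (hT.1 M hM N hN) ?_⟩
      have h1 : n - (M.b - M.a).val ≤ n - (N.b - N.a).val := not_lt.1 (hmin N hN)
      have h2 := ZMod.val_lt (M.b - M.a)
      have h3 := ZMod.val_lt (N.b - N.a)
      omega
  obtain ⟨a, ha⟩ := key
  have hL : (TaggedEdge.loop (by omega : 2 ≤ n) a 1).a = (TaggedEdge.loop (by omega) a 1).b := rfl
  refine hno (TaggedEdge.loop (by omega) a 1) (hT.mem_of_crossNum_eq_zero ?_ ?_) hL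
  · rw [crossNum_loop_left hL]
    exact ⟨fun _ => Or.inl rfl, fun h => absurd hL h⟩
  · intro N hN
    have : AvoidsLoop a 1 N := ⟨fun h => absurd h (hno N hN), fun _ => ha N hN⟩
    exact ⟨(crossNum_loop_left hL N).2 this, (crossNum_loop_right hL N).2 this⟩

/-- Every triangulation of the punctured polygon has exactly `n` elements. -/
theorem triangulation_card (n : ℕ) (hn : 3 ≤ n) (T : Set (TaggedEdge n))
    (hT : IsTriangulation T) : T.ncard = n := by
  have : NeZero n := ⟨by omega⟩
  obtain ⟨L, hL, hLab⟩ := hT.exists_loop hn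
  have hav : ∀ M ∈ T, AvoidsLoop L.a L.ε M :=
    fun M hM => (crossNum_loop_left hLab M).1 (hT.1 L hL M hM)
  rw [← Set.InjOn.ncard_image ((edgeInterval_injOn L.a L.ε).mono hav)]
  rw [ncard_maximal_noncrossing (N := n + 1) (by omega)]
  · omega
  · rintro _ ⟨M, hM, rfl⟩
    exact edgeInterval_bounds (by omega) (hav M hM)
  · rintro _ ⟨M, hM, rfl⟩ _ ⟨N, hN, rfl⟩
    exact ((crossNum_iff_intervalCross hn (hav M hM) (hav N hN)).1 (hT.1 M hM N hN)).1
  · intro I h1 h2 hI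
    obtain ⟨M, hM, rfl⟩ := exists_edgeInterval_eq (by omega) L.a L.ε I h1 h2
    refine ⟨M, hT.mem_of_crossNum_eq_zero ?_ fun N hN => ?_, rfl⟩
    · rw [crossNum_iff_intervalCross hn hM hM]
      simp only [IntervalCross]
      omega
    · rw [crossNum_iff_intervalCross hn hM (hav N hN), crossNum_iff_intervalCross hn (hav N hN) hM]
      have := hI _ (Set.mem_image_of_mem _ hN)
      exact ⟨this, this.symm⟩
end

section
/- If a triangulation T of the punctured polygon contains no tagged edge M_{a,b} with a ≠ b, then there is a single tag ε ∈ {+1,−1} such that T = {M_{a,a}^ε : a ∈ ℤ/nℤ}; in particular T consists of exactly one loop edge at each vertex, all with the same tag. -/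
theorem crossNum_eq_zero_of_loops {n : ℕ} {M N : TaggedEdge n} (hM : M.a = M.b) (hN : N.a = N.b)
    (h : M.ε = N.ε) : crossNum M N = 0 := by
  simp [crossNum, hM, hN, h]

theorem eq_vertex_of_crossNum_eq_zero {n : ℕ} {M N : TaggedEdge n} (hM : M.a = M.b)
    (hN : N.a = N.b) (h : M.ε ≠ N.ε) (h0 : crossNum M N = 0) : M.a = N.a := by
  by_contra hne
  simp only [crossNum, if_pos hM, if_pos hN, if_pos (And.intro hne h)] at h0
  exact one_ne_zero h0

theorem not_memOO_left {n : ℕ} (u v : ZMod n) : ¬ memOO u u v := fun h => h.2.1 rfl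

theorem crossNum_loop_left_s4 {n : ℕ} {M N : TaggedEdge n} (hM : M.a = M.b) (hN : N.a ≠ N.b)
    (h : M.a = N.a) : crossNum M N = 0 := by
  rw [crossNum, if_pos hM, if_neg hN, h, if_neg (not_memOO_left _ _)]

theorem crossNum_loop_right_s4 {n : ℕ} {M N : TaggedEdge n} (hM : M.a ≠ M.b) (hN : N.a = N.b)
    (h : N.a = M.a) : crossNum M N = 0 := by
  rw [crossNum, if_neg hM, if_pos hN, h, if_neg (not_memOO_left _ _)]

theorem ZMod.val_neg_one_of_two_le {n : ℕ} (hn : 2 ≤ n) : (-1 : ZMod n).val = n - 1 := by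
  obtain ⟨m, rfl⟩ := Nat.exists_eq_add_of_le' hn
  exact ZMod.val_neg_one (m + 1)

theorem ZMod.eq_neg_one_of_le_val {n : ℕ} (hn : 2 ≤ n) {x : ZMod n}
    (hx : (-1 : ZMod n).val ≤ x.val) : x = -1 := by
  have : NeZero n := ⟨by omega⟩
  apply ZMod.val_injective n
  have := ZMod.val_lt x
  rw [ZMod.val_neg_one_of_two_le hn] at hx ⊢
  omega

/-- The edge `M_{a,a-1}` joining `a` to its clockwise neighbor around the puncture. -/
def longEdge {n : ℕ} (hn : 3 ≤ n) (a : ZMod n) : TaggedEdge n where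
  a := a
  b := a - 1
  ε := 1
  tag_eq_one := fun _ => rfl
  three_le := by
    have h : a - 1 - a = -1 := by ring
    unfold deltaLen
    rw [h, ZMod.val_neg_one_of_two_le (by omega)]
    split <;> omega

theorem longEdge_ne {n : ℕ} (hn : 3 ≤ n) (a : ZMod n) :
    (longEdge hn a).a ≠ (longEdge hn a).b := by
  have : Fact (1 < n) := ⟨by omega⟩
  intro h
  exact one_ne_zero (sub_eq_self.mp h.symm)

theorem crossNum_longEdge_self {n : ℕ} (hn : 3 ≤ n) (a : ZMod n) :
    crossNum (longEdge hn a) (longEdge hn a) = 0 := by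
  have : Fact (1 < n) := ⟨by omega⟩
  have hne := longEdge_ne hn a
  have h2 : (2 : ZMod n) ≠ 0 := by
    intro h
    have := (ZMod.natCast_eq_zero_iff 2 n).mp (by exact_mod_cast h)
    exact absurd (Nat.le_of_dvd (by omega) this) (by omega)
  have e : a - (a + 1) = -1 := by ring
  have c1 : ¬ memOO a (a + 1) (a - 1) := by
    rintro ⟨h, -⟩
    unfold memCC at h
    rw [e] at h
    have := ZMod.eq_neg_one_of_le_val (by omega) h
    exact one_ne_zero (α := ZMod n) (by linear_combination -this)
  have c2 : ¬ memCC a (a + 1) (a - 1 - 1) := by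
    intro h
    unfold memCC at h
    rw [e] at h
    have := ZMod.eq_neg_one_of_le_val (by omega) h
    exact h2 (by linear_combination -this)
  have c3 : ¬ memCC a (a - 1) (a - 1) := by
    intro h
    unfold memCC at h
    rw [sub_self, ZMod.val_zero, Nat.le_zero, ZMod.val_eq_zero] at h
    exact one_ne_zero (α := ZMod n) (by linear_combination h)
  simp only [crossNum, if_neg hne]
  simp only [longEdge, c1, c2, c3, false_and, or_self, if_false]

/-- If a triangulation contains no tagged edge `M_{a,b}` with `a ≠ b`, then there is
a single tag `ε` such that the triangulation consists exactly of the loop edges `M_{a,a}^ε`,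
one at each vertex `a`, all with the same tag `ε`. -/
theorem triangulation_of_loops (n : ℕ) (hn : 3 ≤ n) (T : Set (TaggedEdge n))
    (hT : IsTriangulation T) (h : ∀ M ∈ T, M.a = M.b) :
    ∃ ε : ℤˣ, T = {M : TaggedEdge n | M.a = M.b ∧ M.ε = ε} := by
  obtain ⟨hcross, hmax⟩ := hT
  by_cases hε : ∃ ε : ℤˣ, ∀ M ∈ T, M.ε = ε
  · obtain ⟨ε, hε⟩ := hε
    refine ⟨ε, (hmax {M | M.a = M.b ∧ M.ε = ε} ?_ fun M hM => ⟨h M hM, hε M hM⟩).symm⟩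
    rintro M ⟨hM, hMε⟩ N ⟨hN, hNε⟩
    exact crossNum_eq_zero_of_loops hM hN (hMε.trans hNε.symm)
  · exfalso
    push Not at hε
    obtain ⟨P, hP, -⟩ := hε 1
    obtain ⟨Q, hQ, hQP⟩ := hε P.ε
    have hvertex : ∀ M ∈ T, M.a = P.a := by
      intro M hM
      by_cases hMP : M.ε = P.ε
      · have h1 := eq_vertex_of_crossNum_eq_zero (h M hM) (h Q hQ)
          (fun e => hQP (e.symm.trans hMP)) (hcross M hM Q hQ)
        exact h1.trans (eq_vertex_of_crossNum_eq_zero (h Q hQ) (h P hP) hQP (hcross Q hQ P hP))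
      · exact eq_vertex_of_crossNum_eq_zero (h M hM) (h P hP) hMP (hcross M hM P hP)
    have hne := longEdge_ne hn P.a
    have hins := hmax (insert (longEdge hn P.a) T) ?_ (Set.subset_insert _ _)
    · exact hne (h _ (hins ▸ Set.mem_insert _ _))
    rintro M (rfl | hM) N (rfl | hN)
    · exact crossNum_longEdge_self hn P.a
    · exact crossNum_loop_right_s4 hne (h N hN) (hvertex N hN)
    · exact crossNum_loop_left_s4 (h M hM) hne (hvertex M hM)
    · exact hcross M hM N hN
end

section
/- Let ρ be the map on ℤ × (tagged edges) given by ρ(i,M) = (i+1,M). Then: (1) if n is even, ρ = τ_Γ^{−n}; (2) if n is odd and M = M_{a,b} with a ≠ b, then ρ(i,M) = τ_Γ^{−n}(i,M) for all i ∈ ℤ; (3) if n is odd and M = M_{a,a}^ε, then ρ(i,M) = τ_Γ^{−n}(i, M_{a,a}^{−ε}) for all i ∈ ℤ. -/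
attribute [ext] TaggedEdge

theorem mem_fan_iff {n : ℕ} [NeZero n] (a₁ : ZMod n) (M : TaggedEdge n) :
    M ∈ fan a₁ ↔ M.a = a₁ := by
  refine ⟨fun h => h.1, fun h => ⟨h, ?_⟩⟩
  subst h
  by_cases hab : M.a = M.b
  · exact Or.inl hab.symm
  · have h3 := M.three_le
    rw [deltaLen, if_neg hab] at h3
    refine Or.inr ⟨(M.b - M.a).val + 1, h3, ZMod.val_lt _, ?_⟩
    rw [Nat.cast_succ, ZMod.natCast_zmod_val]
    ring

theorem tau_iterate {n : ℕ} (M : TaggedEdge n) (k : ℕ) :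
    (tau^[k] M).a = M.a - k ∧ (tau^[k] M).b = M.b - k ∧
      (tau^[k] M).ε = if M.a = M.b then (-1) ^ k * M.ε else M.ε := by
  induction k with
  | zero => simp
  | succ k ih =>
    obtain ⟨ha, hb, hε⟩ := ih
    rw [Function.iterate_succ_apply']
    refine ⟨?_, ?_, ?_⟩
    · simp only [tau, ha]
      push_cast
      ring
    · simp only [tau, hb]
      push_cast
      ring
    · simp only [tau, ha, hb, hε, sub_left_inj]
      split_ifs
      · rw [pow_succ', neg_one_mul, neg_mul]
      · rfl

theorem tauGamma_iterate {n : ℕ} [NeZero n] (a₁ : ZMod n) (i : ℤ) (M : TaggedEdge n) (k : ℕ) :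
    (tauGamma a₁)^[k] (i, M) =
      (i - ((Finset.range k).filter fun j : ℕ => M.a - j = a₁).card, tau^[k] M) := by
  induction k with
  | zero => simp
  | succ k ih =>
    rw [Function.iterate_succ_apply', ih, Function.iterate_succ_apply', tauGamma]
    simp only [mem_fan_iff, (tau_iterate M k).1, Finset.range_add_one, Finset.filter_insert]
    split_ifs with h
    · rw [Finset.card_insert_of_notMem (by simp)]
      push_cast
      rw [sub_sub]
    · rfl

theorem card_filter_range_sub_eq {n : ℕ} [NeZero n] (a a₁ : ZMod n) :
    ((Finset.range n).filter fun j : ℕ => a - j = a₁).card = 1 := by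
  rw [Finset.card_eq_one]
  refine ⟨(a - a₁).val, Finset.ext fun j => ?_⟩
  simp only [Finset.mem_filter, Finset.mem_range, Finset.mem_singleton]
  constructor
  · rintro ⟨hj, rfl⟩
    rw [sub_sub_cancel, ZMod.val_cast_of_lt hj]
  · rintro rfl
    exact ⟨ZMod.val_lt _, by rw [ZMod.natCast_zmod_val, sub_sub_cancel]⟩

theorem tauGamma_iterate_self {n : ℕ} [NeZero n] (a₁ : ZMod n) (i : ℤ) (M : TaggedEdge n) :
    (tauGamma a₁)^[n] (i, M) = (i - 1, tau^[n] M) := by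
  rw [tauGamma_iterate, card_filter_range_sub_eq, Nat.cast_one]

theorem tau_iterate_self_of_even {n : ℕ} (hn : Even n) (M : TaggedEdge n) :
    tau^[n] M = M := by
  obtain ⟨ha, hb, hε⟩ := tau_iterate M n
  ext1
  · simpa using ha
  · simpa using hb
  · simpa [hn.neg_one_pow] using hε

theorem tau_iterate_self_of_ne {n : ℕ} (M : TaggedEdge n) (h : M.a ≠ M.b) :
    tau^[n] M = M := by
  obtain ⟨ha, hb, hε⟩ := tau_iterate M n
  ext1
  · simpa using ha
  · simpa using hb
  · simpa [h] using hε

theorem tau_iterate_self_of_odd {n : ℕ} (hn : Odd n) (M : TaggedEdge n) (h : M.a = M.b) :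
    tau^[n] M = negLoop M h := by
  obtain ⟨ha, hb, hε⟩ := tau_iterate M n
  ext1
  · simpa [negLoop] using ha
  · simpa [negLoop] using hb
  · rw [hε, if_pos h, hn.neg_one_pow, neg_one_mul, negLoop]

/-- Let `ρ(i,M) = (i+1,M)` and let `σ` be the inverse of `τ_Γ`, so that `σ^[n]` is
`τ_Γ^{-n}`. Then: (1) if `n` is even, `ρ = τ_Γ^{-n}`; (2) if `n` is odd and `M = M_{a,b}` with
`a ≠ b`, then `ρ(i,M) = τ_Γ^{-n}(i,M)`; (3) if `n` is odd and `M = M_{a,a}^ε`, then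
`ρ(i,M) = τ_Γ^{-n}(i, M_{a,a}^{-ε})`. -/
theorem rho_eq_tauGamma_neg_n (n : ℕ) (hn : 3 ≤ n) (a₁ : ZMod n)
    (σ : ℤ × TaggedEdge n → ℤ × TaggedEdge n)
    (hσ₁ : Function.LeftInverse σ (tauGamma a₁))
    (hσ₂ : Function.RightInverse σ (tauGamma a₁)) :
    (Even n → ∀ v : ℤ × TaggedEdge n, σ^[n] v = (v.1 + 1, v.2)) ∧
    (Odd n → ∀ (i : ℤ) (M : TaggedEdge n), M.a ≠ M.b → σ^[n] (i, M) = (i + 1, M)) ∧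
    (Odd n → ∀ (i : ℤ) (M : TaggedEdge n) (h : M.a = M.b),
      σ^[n] (i, negLoop M h) = (i + 1, M)) := by
  have : NeZero n := ⟨by omega⟩
  have key (i : ℤ) (M : TaggedEdge n) : σ^[n] (i, tau^[n] M) = (i + 1, M) := by
    have := hσ₁.iterate n (i + 1, M)
    rwa [tauGamma_iterate_self, add_sub_cancel_right] at this
  refine ⟨fun hn v => ?_, fun _ i M h => ?_, fun hn i M h => ?_⟩
  · simpa only [tau_iterate_self_of_even hn] using key v.1 v.2
  · simpa only [tau_iterate_self_of_ne M h] using key i M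
  · simpa only [tau_iterate_self_of_odd hn M h] using key i M
end

section
/- Let M = M_{a,b} be a tagged edge with a ≠ b, set m = |δ_{a,b}| − 2, and let N = M_{x,y} be a tagged edge with x ≠ y; set i = ((x−a) mod n) + 1 ∈ {1,…,n} and j = |δ_{x,y}| − 2 ∈ {1,…,n−2}. Then e(τM, N) = 1 if and only if (1 ≤ i ≤ m and m+1 ≤ i+j ≤ n−1) or (m+1 ≤ i ≤ n−1 and n ≤ i+j ≤ n+m−1). -/
/-- The length of the counterclockwise path from `u` to `v`, in terms of the positions of `u`
and `v` relative to a base point `o`. -/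
lemma val_sub_eq_ite {n : ℕ} [NeZero n] (o u v : ZMod n) :
    (v - u).val = if (u - o).val ≤ (v - o).val then (v - o).val - (u - o).val
      else (v - o).val + n - (u - o).val := by
  have h : v - u = (v - o) - (u - o) := by ring
  have hlt := ZMod.val_lt (u - o)
  rw [h]
  generalize u - o = s at *
  generalize v - o = t at *
  split_ifs with hst
  · exact ZMod.val_sub hst
  · have hcast : t - s = ((t.val + n - s.val : ℕ) : ZMod n) := by
      rw [Nat.cast_sub (by omega)]
      simp
    rw [hcast, ZMod.val_natCast, Nat.mod_eq_of_lt (by omega)]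

lemma eq_iff_val_sub_eq {n : ℕ} [NeZero n] (o u v : ZMod n) :
    u = v ↔ (u - o).val = (v - o).val := by
  rw [(ZMod.val_injective n).eq_iff, sub_left_inj]

/-- The position of a vertex obtained by adding `k` to the base point. -/
lemma val_sub_of_eq_add_natCast {n : ℕ} {o u : ZMod n} {k : ℕ} (hk : k < n)
    (h : u = o + k) : (u - o).val = k := by
  rw [h, add_sub_cancel_left, ZMod.val_natCast, Nat.mod_eq_of_lt hk]

/-- For `M = M_{a,b}` (`a ≠ b`) with `m = |δ_{a,b}| - 2`, and `N = M_{x,y}`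
(`x ≠ y`) with `i = ((x-a) mod n) + 1` and `j = |δ_{x,y}| - 2`, one has `e(τM, N) = 1` iff
`(1 ≤ i ≤ m and m+1 ≤ i+j ≤ n-1)` or `(m+1 ≤ i ≤ n-1 and n ≤ i+j ≤ n+m-1)`. -/
theorem cross_tau_eq_one_iff (n : ℕ) (hn : 3 ≤ n) (M N : TaggedEdge n)
    (hM : M.a ≠ M.b) (hN : N.a ≠ N.b) (m i j : ℕ)
    (hm : m = deltaLen M.a M.b - 2)
    (hi : i = (N.a - M.a).val + 1)
    (hj : j = deltaLen N.a N.b - 2) :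
    crossNum (tau M) N = 1 ↔
      ((1 ≤ i ∧ i ≤ m ∧ m + 1 ≤ i + j ∧ i + j ≤ n - 1) ∨
       (m + 1 ≤ i ∧ i ≤ n - 1 ∧ n ≤ i + j ∧ i + j ≤ n + m - 1)) := by
  have : NeZero n := ⟨by omega⟩
  obtain ⟨a, b, ε, hε, hd⟩ := M
  obtain ⟨x, y, ε', hε', hq⟩ := N
  dsimp only at hM hN hm hi hj
  have hab : a - 1 ≠ b - 1 := fun h => hM (sub_left_injective h)
  simp only [deltaLen, if_neg hM] at hm hd
  simp only [deltaLen, if_neg hN] at hj hq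
  have hdn := ZMod.val_lt (b - a)
  have hpn := ZMod.val_lt (x - a)
  have hyn := ZMod.val_lt (y - a)
  rw [val_sub_eq_ite a x y] at hj hq
  have ha0 : (a - 1 + 1 - a).val = 0 := by simp
  have ha1 : (a - 1 - a).val = n - 1 :=
    val_sub_of_eq_add_natCast (by omega) (by rw [Nat.cast_sub (by omega)]; simp; ring)
  have ha2 : (a - 1 - 1 - a).val = n - 2 :=
    val_sub_of_eq_add_natCast (by omega) (by rw [Nat.cast_sub (by omega)]; simp; ring)
  have hb0 : (b - 1 + 1 - a).val = (b - a).val := by rw [sub_add_cancel]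
  have hb1 : (b - 1 - a).val = (b - a).val - 1 :=
    val_sub_of_eq_add_natCast (by omega) (by rw [Nat.cast_sub (by omega)]; simp; ring)
  have hb2 : (b - 1 - 1 - a).val = (b - a).val - 2 :=
    val_sub_of_eq_add_natCast (by omega) (by rw [Nat.cast_sub (by omega)]; simp; ring)
  simp only [crossNum, tau, if_neg hab, if_neg hN, memOO, memCC, ne_eq]
  rw [ne_eq, eq_iff_val_sub_eq a] at hN
  simp only [eq_iff_val_sub_eq a y x, eq_iff_val_sub_eq a x, val_sub_eq_ite a (a - 1 + 1),
    val_sub_eq_ite a (b - 1), val_sub_eq_ite a (a - 1) y, eq_iff_val_sub_eq a y,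
    val_sub_eq_ite a (a - 1) x, val_sub_eq_ite a (b - 1 + 1), ha0, ha1, ha2, hb0, hb1, hb2,
    Nat.zero_le, if_true, Nat.sub_zero]
  clear ha0 ha1 ha2 hb0 hb1 hb2
  generalize (x - a).val = p at *
  generalize (y - a).val = r at *
  generalize (b - a).val = d at *
  rw [ite_eq_iff, ite_eq_iff]
  simp only [OfNat.ofNat_ne_one, and_false, false_or, and_true, zero_ne_one, or_false]
  have hrp : ((if n - 1 ≤ r then r - (n - 1) else r + n - (n - 1)) ≤
      if n - 1 ≤ p then p - (n - 1) else p + n - (n - 1)) ↔ r = n - 1 ∨ p ≠ n - 1 ∧ r ≤ p := by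
    split_ifs <;> omega
  have hdr : ((if d ≤ r then r - d else r + n - d) ≤
      if d ≤ n - 1 then n - 1 - d else n - 1 + n - d) ↔ d ≤ r := by
    split_ifs <;> omega
  have hdp : ((if d - 1 ≤ p then p - (d - 1) else p + n - (d - 1)) ≤
      if d - 1 ≤ n - 2 then n - 2 - (d - 1) else n - 2 + n - (d - 1)) ↔
      d - 1 ≤ p ∧ p ≤ n - 2 := by
    split_ifs <;> omega
  rw [hrp, hdr, hdp]
  clear hrp hdr hdp hab
  subst hi hm
  split_ifs at hj hq with hpr <;> subst hj <;> constructor <;> intro h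
  all_goals omega
end

section
/- Let M = M_{a,b} be a tagged edge with a ≠ b, set m = |δ_{a,b}| − 2, and let N = M_{x,y} be a tagged edge with x ≠ y; set i = ((x−a) mod n) + 1 ∈ {1,…,n} and j = |δ_{x,y}| − 2 ∈ {1,…,n−2}. Then e(τM, N) = 2 if and only if m ≥ 2, 2 ≤ i ≤ m, n ≤ i+j, and 2 ≤ j ≤ n−2. -/
theorem memOO_iff_val_sub {n : ℕ} [NeZero n] (x u v : ZMod n) :
    memOO x u v ↔ 0 < (x - u).val ∧ (x - u).val < (v - u).val := by
  have hu : x = u ↔ (x - u).val = 0 := by rw [ZMod.val_eq_zero, sub_eq_zero]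
  have hv : x = v ↔ (x - u).val = (v - u).val := by
    rw [(ZMod.val_injective n).eq_iff, sub_left_inj]
  unfold memOO memCC
  rw [Ne, Ne, hu, hv]
  omega

theorem crossNum_eq_two_iff {n : ℕ} {M N : TaggedEdge n} (hM : M.a ≠ M.b) (hN : N.a ≠ N.b) :
    crossNum M N = 2 ↔ memOO N.a (M.a + 1) M.b ∧ memOO N.b M.a N.a := by
  unfold crossNum
  rw [if_neg hM, if_neg hN]
  split_ifs <;> simp_all

theorem val_sub_add_val_sub {n : ℕ} [NeZero n] (a x y : ZMod n) :
    (y - a).val = (x - a).val + (y - x).val ∨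
      (y - a).val + n = (x - a).val + (y - x).val := by
  rw [← sub_add_sub_cancel' x a y]
  rcases lt_or_ge ((x - a).val + (y - x).val) n with h | h
  · exact Or.inl (ZMod.val_add_of_lt h)
  · exact Or.inr (ZMod.val_add_val_of_le h).symm

/-- For `M = M_{a,b}` (`a ≠ b`) with `m = |δ_{a,b}| - 2`, and `N = M_{x,y}`
(`x ≠ y`) with `i = ((x-a) mod n) + 1` and `j = |δ_{x,y}| - 2`, one has `e(τM, N) = 2` iff
`m ≥ 2`, `2 ≤ i ≤ m`, `n ≤ i+j`, and `2 ≤ j ≤ n-2`. -/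
theorem cross_tau_eq_two_iff (n : ℕ) (hn : 3 ≤ n) (M N : TaggedEdge n)
    (hM : M.a ≠ M.b) (hN : N.a ≠ N.b) (m i j : ℕ)
    (hm : m = deltaLen M.a M.b - 2)
    (hi : i = (N.a - M.a).val + 1)
    (hj : j = deltaLen N.a N.b - 2) :
    crossNum (tau M) N = 2 ↔
      (2 ≤ m ∧ 2 ≤ i ∧ i ≤ m ∧ n ≤ i + j ∧ 2 ≤ j ∧ j ≤ n - 2) := by
  have : NeZero n := ⟨by omega⟩
  have : Fact (1 < n) := ⟨by omega⟩
  have hτ : (tau M).a ≠ (tau M).b := fun h => hM (sub_left_injective h)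
  rw [crossNum_eq_two_iff hτ hN, memOO_iff_val_sub, memOO_iff_val_sub]
  change (0 < (N.a - (M.a - 1 + 1)).val ∧
      (N.a - (M.a - 1 + 1)).val < (M.b - 1 - (M.a - 1 + 1)).val) ∧
    (0 < (N.b - (M.a - 1)).val ∧ (N.b - (M.a - 1)).val < (N.a - (M.a - 1)).val) ↔ _
  rw [sub_add_cancel]
  have hMlen := M.three_le
  have hNlen := N.three_le
  rw [deltaLen_of_ne hM] at hm hMlen
  rw [deltaLen_of_ne hN] at hj hNlen
  have h_one : (M.a - (M.a - 1)).val = 1 := by rw [sub_sub_cancel, ZMod.val_one]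
  have h_pred : (M.b - 1 - M.a).val = (M.b - M.a).val - 1 := by
    rw [sub_right_comm, ZMod.val_sub (by rw [ZMod.val_one]; omega), ZMod.val_one]
  have hx := val_sub_add_val_sub (M.a - 1) M.a N.a
  have hy := val_sub_add_val_sub (M.a - 1) N.a N.b
  have lt_ab := (M.b - M.a).val_lt
  have lt_ax := (N.a - M.a).val_lt
  have lt_xy := (N.b - N.a).val_lt
  have lt_y := (N.b - (M.a - 1)).val_lt
  have lt_x := (N.a - (M.a - 1)).val_lt
  omega
end
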